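/- Let A be a unital C*-algebra whose pure state space M = PS(A) (with the weak-* topology) admits an isocone I of A such that the Gelfand transform image G(I) ⊆ I(M) is stable under pointwise max and min. Then A is abelian. -/

import Mathlib

noncomputable section

def cstarVee {A : Type*} [CStarAlgebra A] [PartialOrder A] [StarOrderedRing A] (a b : A) : A :=
  (2 : ℝ)⁻¹ • (a + b + CFC.sqrt (star (a - b) * (a - b)))

def cstarWedge {A : Type*} [CStarAlgebra A] [PartialOrder A] [StarOrderedRing A] (a b : A) : A :=
  (2 : ℝ)⁻¹ • (a + b - CFC.sqrt (star (a - b) * (a - b)))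

structure IsIsocone (A : Type*) [CStarAlgebra A] [PartialOrder A] [StarOrderedRing A]
    (I : Set A) : Prop where
  selfAdjoint : ∀ a ∈ I, IsSelfAdjoint a
  closed : IsClosed I
  add_mem : ∀ a ∈ I, ∀ b ∈ I, a + b ∈ I
  smul_mem : ∀ (r : ℝ), 0 ≤ r → ∀ a ∈ I, r • a ∈ I
  vee_mem : ∀ a ∈ I, ∀ b ∈ I, cstarVee a b ∈ I
  wedge_mem : ∀ a ∈ I, ∀ b ∈ I, cstarWedge a b ∈ I
  const_mem : ∀ r : ℝ, r • (1 : A) ∈ I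
  dense_span : Dense (Submodule.span ℂ I : Set A)

/-- The set of states of `A`, inside the weak-* dual. -/
def stateSet (A : Type*) [CStarAlgebra A] [PartialOrder A] [StarOrderedRing A] :
    Set (WeakDual ℂ A) :=
  {φ | φ 1 = 1 ∧ ∀ a : A, 0 ≤ a → 0 ≤ (φ a).re ∧ (φ a).im = 0}

/-- The pure states: extreme points of the state space. -/
def pureStateSet (A : Type*) [CStarAlgebra A] [PartialOrder A] [StarOrderedRing A] :
    Set (WeakDual ℂ A) :=
  Set.extremePoints ℝ (stateSet A)

/-- A closed convex set containing the extreme points of a compact convex set contains that set. -/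
theorem IsCompact.subset_of_extremePoints_subset {E : Type*} [AddCommGroup E] [Module ℝ E]
    [TopologicalSpace E] [T2Space E] [IsTopologicalAddGroup E] [ContinuousSMul ℝ E]
    [LocallyConvexSpace ℝ E] {s t : Set E} (hs : IsCompact s) (hs' : Convex ℝ s)
    (ht : IsClosed t) (ht' : Convex ℝ t) (h : s.extremePoints ℝ ⊆ t) : s ⊆ t := by
  rw [← closure_convexHull_extremePoints hs hs']
  exact closure_minimal (convexHull_min h ht') ht

section PureStates

variable {A : Type*} [CStarAlgebra A]

theorem weakDual_locallyConvexSpace_real : LocallyConvexSpace ℝ (WeakDual ℂ A) := by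
  let coeLinear : WeakDual ℂ A →ₗ[ℝ] (A → ℂ) :=
    { toFun := fun φ => φ
      map_add' := fun _ _ => rfl
      map_smul' := fun _ _ => rfl }
  exact LocallyConvexSpace.induced coeLinear

theorem weakDual_subset_of_extremePoints_subset {s t : Set (WeakDual ℂ A)} (hs : IsCompact s)
    (hs' : Convex ℝ s) (ht : IsClosed t) (ht' : Convex ℝ t) (h : s.extremePoints ℝ ⊆ t) :
    s ⊆ t :=
  have := weakDual_locallyConvexSpace_real (A := A)
  @IsCompact.subset_of_extremePoints_subset (WeakDual ℂ A) inferInstance inferInstance inferInstance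
    inferInstance inferInstance inferInstance this s t hs hs' ht ht' h

/-- The functional `x ↦ φ (star u * x * u)`. -/
def conjFunctional (u : A) (φ : WeakDual ℂ A) : WeakDual ℂ A :=
  StrongDual.toWeakDual
    ((WeakDual.toStrongDual φ).comp (ContinuousLinearMap.mulLeftRight ℂ A (star u) u))

theorem conjFunctional_apply (u : A) (φ : WeakDual ℂ A) (x : A) :
    conjFunctional u φ x = φ (star u * x * u) := rfl

theorem conjFunctional_conjFunctional_star {u : A} (hu : u ∈ unitary A) (φ : WeakDual ℂ A) :
    conjFunctional u (conjFunctional (star u) φ) = φ := by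
  refine DFunLike.ext _ _ fun x => ?_
  simp only [conjFunctional_apply, star_star]
  congr 1
  calc u * (star u * x * u) * star u = (u * star u) * x * (u * star u) := by noncomm_ring
    _ = x := by simp [Unitary.mul_star_self_of_mem hu]

theorem conjFunctional_mem_openSegment {u : A} {φ φ₁ φ₂ : WeakDual ℂ A}
    (h : φ ∈ openSegment ℝ φ₁ φ₂) :
    conjFunctional u φ ∈ openSegment ℝ (conjFunctional u φ₁) (conjFunctional u φ₂) := by
  obtain ⟨s, t, hs, ht, hst, rfl⟩ := h
  exact ⟨s, t, hs, ht, hst, rfl⟩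

variable [PartialOrder A] [StarOrderedRing A]

theorem conjFunctional_mem_stateSet {u : A} (hu : u ∈ unitary A) {φ : WeakDual ℂ A}
    (hφ : φ ∈ stateSet A) : conjFunctional u φ ∈ stateSet A := by
  refine ⟨?_, fun x hx => hφ.2 _ (star_left_conjugate_nonneg hx u)⟩
  simpa [conjFunctional_apply, Unitary.star_mul_self_of_mem hu] using hφ.1

theorem conjFunctional_mem_pureStateSet {u : A} (hu : u ∈ unitary A) {φ : WeakDual ℂ A}
    (hφ : φ ∈ pureStateSet A) : conjFunctional u φ ∈ pureStateSet A := by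
  have hu' : star u ∈ unitary A := Unitary.star_mem hu
  refine mem_extremePoints_iff_left.2
    ⟨conjFunctional_mem_stateSet hu hφ.1, fun φ₁ h₁ φ₂ h₂ h => ?_⟩
  have h' := conjFunctional_mem_openSegment (u := star u) h
  have hinv := conjFunctional_conjFunctional_star hu' φ
  rw [star_star] at hinv
  rw [hinv] at h'
  rw [← (mem_extremePoints_iff_left.1 hφ).2 _ (conjFunctional_mem_stateSet hu' h₁) _
    (conjFunctional_mem_stateSet hu' h₂) h', conjFunctional_conjFunctional_star hu]

/-- Every non-positive self-adjoint element takes a negative value at some state. -/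
theorem exists_mem_stateSet_re_neg {x : A} (hx : IsSelfAdjoint x) (hneg : ¬ 0 ≤ x) :
    ∃ φ ∈ stateSet A, (φ x).re < 0 := by
  obtain ⟨f, hf, hfx⟩ := (ProperCone.positive ℝ A).hyperplane_separation_point
    (x₀ := x) (by simpa using hneg)
  replace hf : ∀ y : A, 0 ≤ y → 0 ≤ f y := fun y hy => hf y (by simpa using hy)
  let g : StrongDual ℝ A := f + f.comp (starL' ℝ : A ≃L[ℝ] A).toContinuousLinearMap
  have hg (y : A) : g y = f y + f (star y) := rfl
  have hgsa {y : A} (hy : IsSelfAdjoint y) : g y = 2 * f y := by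
    rw [hg, hy.star_eq]; ring
  have hgI {y : A} (hy : IsSelfAdjoint y) : g (Complex.I • y) = 0 := by
    rw [hg]; simp [hy.star_eq]
  have hone : 0 < f 1 := by
    have h₁ := hf 1 zero_le_one
    have h₂ := hf (algebraMap ℝ A ‖x‖ + x)
      (neg_le_iff_add_nonneg'.1 (IsSelfAdjoint.neg_algebraMap_norm_le_self hx))
    rw [map_add, Algebra.algebraMap_eq_smul_one, map_smul, smul_eq_mul] at h₂
    rcases h₁.eq_or_lt with h | h
    · rw [← h] at h₂
      linarith
    · exact h
  let φ : WeakDual ℂ A := StrongDual.toWeakDual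
    (((2 * f 1)⁻¹ • g).extendRCLike (𝕜 := ℂ))
  have hre (y : A) : (φ y).re = (2 * f 1)⁻¹ * g y :=
    StrongDual.re_extendRCLike_apply (𝕜 := ℂ) ((2 * f 1)⁻¹ • g) y
  have him (y : A) : (φ y).im = -((2 * f 1)⁻¹ * g (Complex.I • y)) :=
    StrongDual.im_extendRCLike_apply (𝕜 := ℂ) ((2 * f 1)⁻¹ • g) y
  refine ⟨φ, ⟨Complex.ext ?_ ?_, fun y hy => ⟨?_, ?_⟩⟩, ?_⟩
  · rw [hre, hgsa (.one A), Complex.one_re]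
    exact inv_mul_cancel₀ (by positivity)
  · rw [him, hgI (.one A)]; simp
  · rw [hre, hgsa (.of_nonneg hy)]
    have := hf y hy
    positivity
  · rw [him, hgI (.of_nonneg hy)]; simp
  · rw [hre, hgsa hx]
    exact mul_neg_of_pos_of_neg (by positivity) (by linarith)

theorem stateSet_re_mono {φ : WeakDual ℂ A} (hφ : φ ∈ stateSet A) {x y : A} (h : x ≤ y) :
    (φ x).re ≤ (φ y).re := by
  have := (hφ.2 _ (sub_nonneg.2 h)).1
  rw [map_sub, Complex.sub_re] at this
  linarith

theorem stateSet_algebraMap_real {φ : WeakDual ℂ A} (hφ : φ ∈ stateSet A) (r : ℝ) :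
    φ (algebraMap ℝ A r) = r := by
  have h : algebraMap ℝ A r = (r : ℂ) • (1 : A) := by
    rw [Algebra.algebraMap_eq_smul_one, Complex.coe_smul]
  rw [h, map_smul, hφ.1, smul_eq_mul, mul_one]

theorem stateSet_im_of_isSelfAdjoint {φ : WeakDual ℂ A} (hφ : φ ∈ stateSet A) {x : A}
    (hx : IsSelfAdjoint x) : (φ x).im = 0 := by
  have h := (hφ.2 (algebraMap ℝ A ‖x‖ + x)
    (neg_le_iff_add_nonneg'.1 (IsSelfAdjoint.neg_algebraMap_norm_le_self hx))).2
  simpa [stateSet_algebraMap_real hφ] using h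

theorem stateSet_norm_le_of_isSelfAdjoint {φ : WeakDual ℂ A} (hφ : φ ∈ stateSet A) {x : A}
    (hx : IsSelfAdjoint x) : ‖φ x‖ ≤ ‖x‖ := by
  have h₁ := stateSet_re_mono hφ (IsSelfAdjoint.neg_algebraMap_norm_le_self hx)
  have h₂ := stateSet_re_mono hφ (IsSelfAdjoint.le_algebraMap_norm_self hx)
  rw [map_neg, stateSet_algebraMap_real hφ, Complex.neg_re, Complex.ofReal_re] at h₁
  rw [stateSet_algebraMap_real hφ, Complex.ofReal_re] at h₂
  rw [← Complex.abs_re_eq_norm.2 (stateSet_im_of_isSelfAdjoint hφ hx)]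
  exact abs_le.2 ⟨h₁, h₂⟩

open ComplexStarModule in
theorem stateSet_norm_le {φ : WeakDual ℂ A} (hφ : φ ∈ stateSet A) (x : A) :
    ‖φ x‖ ≤ 2 * ‖x‖ := by
  have h₁ := stateSet_norm_le_of_isSelfAdjoint hφ (ℜ x).2
  have h₂ := stateSet_norm_le_of_isSelfAdjoint hφ (ℑ x).2
  have h₃ : ‖(ℜ x : A)‖ ≤ ‖x‖ := realPart.norm_le x
  have h₄ : ‖(ℑ x : A)‖ ≤ ‖x‖ := imaginaryPart.norm_le x
  calc ‖φ x‖ = ‖φ (ℜ x : A) + Complex.I • φ (ℑ x : A)‖ := by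
        rw [← map_smul, ← map_add, realPart_add_I_smul_imaginaryPart]
    _ ≤ ‖φ (ℜ x : A)‖ + ‖Complex.I • φ (ℑ x : A)‖ := norm_add_le _ _
    _ = ‖φ (ℜ x : A)‖ + ‖φ (ℑ x : A)‖ := by rw [norm_smul, Complex.norm_I, one_mul]
    _ ≤ 2 * ‖x‖ := by linarith

theorem isClosed_stateSet : IsClosed (stateSet A) := by
  have hset : stateSet A = {φ : WeakDual ℂ A | φ 1 = 1} ∩
      ⋂ (a : A) (_ : 0 ≤ a), {φ | 0 ≤ (φ a).re} ∩ {φ | (φ a).im = 0} := by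
    ext φ
    simp [stateSet]
  have heval (a : A) : Continuous fun φ : WeakDual ℂ A => φ a := WeakDual.eval_continuous a
  rw [hset]
  refine (isClosed_eq (heval 1) continuous_const).inter
    (isClosed_iInter fun a => isClosed_iInter fun _ => IsClosed.inter ?_ ?_)
  · exact isClosed_le continuous_const (Complex.continuous_re.comp (heval a))
  · exact isClosed_eq (Complex.continuous_im.comp (heval a)) continuous_const

theorem isCompact_stateSet : IsCompact (stateSet A) := by
  refine (WeakDual.isCompact_closedBall (𝕜 := ℂ) (0 : StrongDual ℂ A) 2).of_isClosed_subset
    isClosed_stateSet fun φ hφ => ?_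
  rw [Set.mem_preimage, mem_closedBall_zero_iff]
  exact ContinuousLinearMap.opNorm_le_bound _ zero_le_two (stateSet_norm_le hφ)

theorem convex_stateSet : Convex ℝ (stateSet A) := by
  intro φ hφ ψ hψ s t hs ht hst
  have happly (x : A) : (s • φ + t • ψ) x = s • φ x + t • ψ x := rfl
  refine ⟨?_, fun x hx => ?_⟩
  · rw [happly, hφ.1, hψ.1, ← add_smul, hst, one_smul]
  · obtain ⟨h₁, h₂⟩ := hφ.2 x hx
    obtain ⟨h₃, h₄⟩ := hψ.2 x hx
    rw [happly]
    simp only [Complex.add_re, Complex.add_im, Complex.smul_re, Complex.smul_im, smul_eq_mul, h₂,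
      h₄, mul_zero, add_zero, and_true]
    positivity

/-- By Krein–Milman, pure states detect positivity of self-adjoint elements. -/
theorem nonneg_of_forall_pureStateSet {x : A} (hx : IsSelfAdjoint x)
    (h : ∀ φ ∈ pureStateSet A, 0 ≤ (φ x).re) : 0 ≤ x := by
  by_contra hneg
  obtain ⟨φ, hφ, hφx⟩ := exists_mem_stateSet_re_neg hx hneg
  have hclosed : IsClosed {ψ : WeakDual ℂ A | 0 ≤ (ψ x).re} :=
    isClosed_le continuous_const (Complex.continuous_re.comp (WeakDual.eval_continuous x))
  have hconvex : Convex ℝ {ψ : WeakDual ℂ A | 0 ≤ (ψ x).re} := by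
    intro φ₁ h₁ φ₂ h₂ s t hs ht _
    have happly : (s • φ₁ + t • φ₂) x = s • φ₁ x + t • φ₂ x := rfl
    simp only [Set.mem_ofPred_eq] at h₁ h₂ ⊢
    rw [happly]
    simp only [Complex.add_re, Complex.smul_re, smul_eq_mul]
    positivity
  have hpure : (stateSet A).extremePoints ℝ ⊆ {ψ : WeakDual ℂ A | 0 ≤ (ψ x).re} :=
    fun ψ hψ => h ψ hψ
  exact hφx.not_ge
    (weakDual_subset_of_extremePoints_subset isCompact_stateSet convex_stateSet hclosed hconvex
      hpure hφ)

theorem eq_zero_of_forall_pureStateSet {x : A} (hx : IsSelfAdjoint x)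
    (h : ∀ φ ∈ pureStateSet A, (φ x).re = 0) : x = 0 :=
  le_antisymm
    (neg_nonneg.1 (nonneg_of_forall_pureStateSet hx.neg fun φ hφ => by simp [h φ hφ]))
    (nonneg_of_forall_pureStateSet hx fun φ hφ => (h φ hφ).ge)

omit [PartialOrder A] [StarOrderedRing A] in
/-- The derivative at `0` of a functional along the one-parameter group of inner automorphisms
generated by `k`. -/
theorem hasDerivAt_conjFunctional_exp {k : A} (hk : k ∈ skewAdjoint A) (φ : WeakDual ℂ A)
    (x : A) :
    HasDerivAt (fun t : ℝ => (conjFunctional (NormedSpace.exp (t • k)) φ x).re)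
      (φ (x * k - k * x)).re 0 := by
  have hstar (t : ℝ) : star (NormedSpace.exp (t • k)) = NormedSpace.exp (t • (-k)) := by
    rw [NormedSpace.star_exp, star_smul, skewAdjoint.mem_iff.1 hk, star_trivial]
  have h := ((hasDerivAt_exp_smul_const (-k) (0 : ℝ)).mul_const x).mul
    (hasDerivAt_exp_smul_const k (0 : ℝ))
  let l : A →L[ℝ] ℝ := Complex.reCLM.comp ((WeakDual.toStrongDual φ).restrictScalars ℝ)
  refine ((l.hasFDerivAt.comp_hasDerivAt 0 h).congr_deriv ?_).congr_of_eventuallyEq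
    (Filter.Eventually.of_forall fun t => ?_)
  · change (φ _).re = _
    congr 2
    simp [sub_eq_neg_add]
  · change (conjFunctional (NormedSpace.exp (t • k)) φ x).re = (φ _).re
    rw [conjFunctional_apply, hstar]
    rfl

/-- If `c` realizes the maximum of `a` and the constant `φ a` on the pure states, then `φ` vanishes
on commutators of `a` with skew-adjoint elements: both `c` and `c - a` are minimized at `φ` along
its unitary orbit. -/
theorem re_pureState_commutator_eq_zero {φ : WeakDual ℂ A} (hφ : φ ∈ pureStateSet A) {a c k : A}
    (hk : k ∈ skewAdjoint A)
    (hc : ∀ ψ ∈ pureStateSet A, (ψ c).re = max (ψ a).re (φ a).re) :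
    (φ (a * k - k * a)).re = 0 := by
  let orbit (t : ℝ) : WeakDual ℂ A := conjFunctional (NormedSpace.exp (t • k)) φ
  have horbit (t : ℝ) : orbit t ∈ pureStateSet A := by
    let +nondep : NormedAlgebra ℚ A := .restrictScalars ℚ ℂ A
    exact conjFunctional_mem_pureStateSet
      (NormedSpace.exp_mem_unitary_of_mem_skewAdjoint (skewAdjoint.smul_mem t hk)) hφ
  have horbit_zero : orbit 0 = φ := by
    refine DFunLike.ext _ _ fun x => ?_
    simp [orbit, conjFunctional_apply]
  have hφc : (φ c).re = (φ a).re := by rw [hc φ hφ, max_self]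
  have hderiv_a := hasDerivAt_conjFunctional_exp hk φ a
  have hderiv_c := hasDerivAt_conjFunctional_exp hk φ c
  have hmin_c : IsLocalMin (fun t => (orbit t c).re) 0 := Filter.Eventually.of_forall fun t => by
    simp only [horbit_zero, hφc, hc _ (horbit t)]
    exact le_max_right _ _
  have hmin_sub : IsLocalMin (fun t => (orbit t c).re - (orbit t a).re) 0 :=
    Filter.Eventually.of_forall fun t => by
      simp only [horbit_zero, hφc, sub_self, hc _ (horbit t)]
      exact sub_nonneg.2 (le_max_left _ _)
  have h₁ := hmin_c.hasDerivAt_eq_zero hderiv_c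
  have h₂ := hmin_sub.hasDerivAt_eq_zero (hderiv_c.sub hderiv_a)
  linarith

end PureStates

open ComplexStarModule in
/-- If the pure state space of `A` admits an isocone `I` whose Gelfand-transform image
is stable under pointwise max and min, then `A` is abelian. -/
theorem stmt_12 {A : Type*} [CStarAlgebra A] [PartialOrder A] [StarOrderedRing A]
    {I : Set A} (hI : IsIsocone A I)
    (hmax : ∀ a ∈ I, ∀ b ∈ I, ∃ c ∈ I, ∀ φ ∈ pureStateSet A,
      (φ c).re = max (φ a).re (φ b).re)
    (hmin : ∀ a ∈ I, ∀ b ∈ I, ∃ c ∈ I, ∀ φ ∈ pureStateSet A,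
      (φ c).re = min (φ a).re (φ b).re) :
    ∀ a b : A, a * b = b * a := by
  have hskew : ∀ a ∈ I, ∀ k ∈ skewAdjoint A, a * k = k * a := by
    intro a ha k hk
    have hsa : IsSelfAdjoint (a * k - k * a) := by
      rw [isSelfAdjoint_iff, star_sub, star_mul, star_mul, (hI.selfAdjoint a ha).star_eq,
        skewAdjoint.mem_iff.1 hk]
      noncomm_ring
    refine sub_eq_zero.1 (eq_zero_of_forall_pureStateSet hsa fun φ hφ => ?_)
    obtain ⟨c, -, hc⟩ := hmax a ha _ (hI.const_mem (φ a).re)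
    refine re_pureState_commutator_eq_zero (c := c) hφ hk fun ψ hψ => ?_
    rw [hc ψ hψ, ← Algebra.algebraMap_eq_smul_one, stateSet_algebraMap_real hψ.1,
      Complex.ofReal_re]
  have hcomm : ∀ a ∈ I, ∀ b : A, a * b = b * a := by
    intro a ha b
    have hre := hskew a ha _ ((ℜ b).2.smul_mem_skewAdjoint Complex.conj_I)
    have him := hskew a ha _ ((ℑ b).2.smul_mem_skewAdjoint Complex.conj_I)
    rw [mul_smul_comm, smul_mul_assoc] at hre
    replace hre := smul_right_injective A Complex.I_ne_zero hre
    rw [← realPart_add_I_smul_imaginaryPart b, mul_add, add_mul, him, hre]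
  intro a b
  have hclosed : IsClosed {x : A | x * b = b * x} :=
    isClosed_eq (continuous_mul_const b) (continuous_const_mul b)
  refine closure_minimal (fun x hx => ?_) hclosed (hI.dense_span a)
  refine Submodule.span_induction (fun x hx => hcomm x hx b) ?_ ?_ ?_ hx
  · simp
  · intro x y _ _ hx hy
    simp_all [add_mul, mul_add]
  · intro r x _ hx
    simp_all

end
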